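/- Let K be a finite field of characteristic different from 2, K̄ an algebraic closure of K, n ≥ 2 an even integer, and G a subgroup of GSp_n(K̄) such that the subgroup of G generated by the transvections contained in G equals Sp_n(K). Then G ⊆ GSp_n(K)·K̄^×: every A ∈ G can be written as A = λ·B with λ ∈ K̄^× and B ∈ GSp_n(K). -/

import Mathlib

open Matrix

noncomputable section

/-- The Gram matrix of the standard symplectic form on `R^n` (for `n` even):
block form `[[0, I], [-I, 0]]`. -/
def stdJ (n : ℕ) (R : Type*) [CommRing R] : Matrix (Fin n) (Fin n) R :=
  Matrix.of fun i j =>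
    if i.val + n / 2 = j.val then 1 else if j.val + n / 2 = i.val then -1 else 0

/-- A transvection: a matrix `T ≠ 1` such that `T - 1` has rank `1`. -/
def IsTransvection {n : ℕ} {R : Type*} [CommRing R]
    (A : Matrix (Fin n) (Fin n) R) : Prop :=
  A ≠ 1 ∧ (A - 1).rank = 1

/-- `Sp_n(K)` viewed inside `GL_n(K̄)`: invertible matrices with entries in (the image
of) `K` satisfying `AᵀJA = J`. -/
def SpOver (K : Type*) [Field K] (n : ℕ) :
    Set (Matrix (Fin n) (Fin n) (AlgebraicClosure K))ˣ :=
  {A | (∀ i j, ∃ b : K, algebraMap K (AlgebraicClosure K) b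
          = (A : Matrix (Fin n) (Fin n) (AlgebraicClosure K)) i j) ∧
    (A : Matrix (Fin n) (Fin n) (AlgebraicClosure K))ᵀ * stdJ n (AlgebraicClosure K)
      * (A : Matrix (Fin n) (Fin n) (AlgebraicClosure K))
      = stdJ n (AlgebraicClosure K)}

section SymplecticForm

variable {R : Type*} [CommRing R] {n : ℕ}

lemma stdJ_transpose (hn : 2 ≤ n) : (stdJ n R)ᵀ = -stdJ n R := by
  ext i j
  rw [transpose_apply, Matrix.neg_apply]
  simp only [stdJ, of_apply]
  split_ifs <;> first | omega | simp

lemma exists_stdJ_ne_zero [Nontrivial R] (hn : Even n) (i : Fin n) :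
    ∃ k, stdJ n R i k ≠ 0 := by
  obtain ⟨m, rfl⟩ := hn
  have hi := i.2
  by_cases h : i.val < m
  · refine ⟨⟨i.val + m, by omega⟩, ?_⟩
    have h2 : i.val + (m + m) / 2 = i.val + m := by omega
    simp [stdJ, h2]
  · refine ⟨⟨i.val - m, by omega⟩, ?_⟩
    have h1 : ¬ i.val + (m + m) / 2 = i.val - m := by omega
    have h2 : i.val - m + (m + m) / 2 = i.val := by omega
    simp [stdJ, h1, h2]

lemma stdJ_zero_half (hn : 2 ≤ n) :
    stdJ n R ⟨0, by omega⟩ ⟨n / 2, by omega⟩ = 1 := by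
  simp [stdJ]

lemma stdJ_map {S : Type*} [CommRing S] (f : R →+* S) :
    (stdJ n R).map f = stdJ n S := by
  ext i j
  simp only [stdJ, map_apply, of_apply]
  split_ifs <;> simp

lemma stdJ_mem_subfield {L : Type*} [Field L] (F : Subfield L) (i j : Fin n) :
    stdJ n L i j ∈ F := by
  simp only [stdJ, of_apply]
  split_ifs
  · exact F.one_mem
  · exact F.neg_mem F.one_mem
  · exact F.zero_mem

end SymplecticForm

section Transvections

variable {L : Type*} [Field L] {n : Type*}

/-- A matrix all of whose products with the entries of a nonzero matrix lie in `F` is a scalar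
multiple of a matrix over `F`. -/
lemma exists_smul_of_mul_mem {F : Subfield L} {A C : Matrix n n L} (hC : C ≠ 0)
    (h : ∀ i j a b, A a i * C j b ∈ F) :
    ∃ c : Lˣ, ∀ i j, (c : L)⁻¹ * A i j ∈ F := by
  obtain ⟨j, b, hjb⟩ : ∃ j b, C j b ≠ 0 := by
    by_contra! hall
    exact hC (ext hall)
  refine ⟨(Units.mk0 _ hjb)⁻¹, fun a i => ?_⟩
  simpa [mul_comm] using h i j a b

variable [Fintype n]

lemma dotProduct_mulVec_self_of_transpose_eq_neg (h2 : (2 : L) ≠ 0) {J : Matrix n n L}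
    (hJ : Jᵀ = -J) (v : n → L) : v ⬝ᵥ (J *ᵥ v) = 0 := by
  have h : v ⬝ᵥ (J *ᵥ v) = -(v ⬝ᵥ (J *ᵥ v)) := by
    conv_lhs => rw [dotProduct_comm, ← vecMul_transpose, ← dotProduct_mulVec, hJ, neg_mulVec,
      dotProduct_neg]
  have h' : (2 : L) * (v ⬝ᵥ (J *ᵥ v)) = 0 := by linear_combination h
  exact (mul_eq_zero.mp h').resolve_left h2

lemma vecMulVec_vecMul_sq {J : Matrix n n L} {v : n → L} (hv : v ⬝ᵥ (J *ᵥ v) = 0) :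
    vecMulVec v (v ᵥ* J) * vecMulVec v (v ᵥ* J) = 0 := by
  rw [vecMulVec_mul_vecMulVec, ← dotProduct_mulVec, hv]
  simp

variable [DecidableEq n]

/-- The symplectic transvection `1 + v vᵀ J` as an invertible matrix. -/
def symplecticTransvection (J : Matrix n n L) (v : n → L) (hv : v ⬝ᵥ (J *ᵥ v) = 0) :
    (Matrix n n L)ˣ where
  val := 1 + vecMulVec v (v ᵥ* J)
  inv := 1 - vecMulVec v (v ᵥ* J)
  val_inv := by
    have := vecMulVec_vecMul_sq hv
    noncomm_ring
    simp [this]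
  inv_val := by
    have := vecMulVec_vecMul_sq hv
    noncomm_ring
    simp [this]

lemma symplecticTransvection_preserves {J : Matrix n n L} (hJ : Jᵀ = -J) {v : n → L}
    (hv : v ⬝ᵥ (J *ᵥ v) = 0) :
    (1 + vecMulVec v (v ᵥ* J))ᵀ * J * (1 + vecMulVec v (v ᵥ* J)) = J := by
  have ht : (vecMulVec v (v ᵥ* J))ᵀ * J = -(J * vecMulVec v (v ᵥ* J)) := by
    rw [transpose_vecMulVec, vecMulVec_mul, mul_vecMulVec, ← mulVec_transpose, hJ, neg_mulVec,
      neg_vecMulVec]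
  rw [transpose_add, transpose_one, add_mul, one_mul, ht, mul_add, mul_one, add_mul, neg_mul,
    mul_assoc, vecMulVec_vecMul_sq hv]
  simp

/-- If the conjugates of all `v vᵀ J`, with `v` having entries in `F`, have entries in `F`,
then so do the conjugates of all `v wᵀ J`. -/
lemma conj_vecMulVec_mem {F : Subfield L} {J A A' : Matrix n n L} (hA : A' * A = 1)
    (hJ : ∀ i j, J i j ∈ F)
    (hself : ∀ v : n → L, (∀ i, v i ∈ F) →
      ∀ a b, (A *ᵥ v) a * (v ᵥ* J ᵥ* A') b ∈ F)
    {u v w : n → L} (hu : ∀ i, u i ∈ F) (hv : ∀ i, v i ∈ F) (hw : ∀ i, w i ∈ F)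
    (huv : v ⬝ᵥ (J *ᵥ u) ≠ 0) (a b : n) :
    (A *ᵥ v) a * (w ᵥ* J ᵥ* A') b ∈ F := by
  have hform : ∀ x y : n → L, (∀ i, x i ∈ F) → (∀ i, y i ∈ F) → x ⬝ᵥ (J *ᵥ y) ∈ F :=
    fun x y hx hy => F.sum_mem fun i _ => F.mul_mem (hx i) <|
      F.sum_mem fun j _ => F.mul_mem (hJ i j) (hy j)
  have key : ∀ y : n → L, (∀ i, y i ∈ F) → v ⬝ᵥ (J *ᵥ y) ≠ 0 →
      (A *ᵥ v) a * (y ᵥ* J ᵥ* A') b ∈ F := by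
    intro y hy hne
    have hc : (v ᵥ* J ᵥ* A') ⬝ᵥ (A *ᵥ y) = v ⬝ᵥ (J *ᵥ y) := by
      rw [dotProduct_mulVec, vecMul_vecMul, hA, vecMul_one, ← dotProduct_mulVec]
    have hmem : v ⬝ᵥ (J *ᵥ y) * ((A *ᵥ v) a * (y ᵥ* J ᵥ* A') b) ∈ F := by
      have : v ⬝ᵥ (J *ᵥ y) * ((A *ᵥ v) a * (y ᵥ* J ᵥ* A') b) =
          ∑ k, ((A *ᵥ v) a * (v ᵥ* J ᵥ* A') k) * ((A *ᵥ y) k * (y ᵥ* J ᵥ* A') b) := by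
        rw [← hc, dotProduct, Finset.sum_mul]
        exact Finset.sum_congr rfl fun k _ => by ring
      rw [this]
      exact F.sum_mem fun k _ => F.mul_mem (hself v hv a k) (hself y hy k b)
    have := F.mul_mem (F.inv_mem (hform v y hv hy)) hmem
    rwa [inv_mul_cancel_left₀ hne] at this
  by_cases h : v ⬝ᵥ (J *ᵥ w) = 0
  · have hwu := key (w + u) (fun i => F.add_mem (hw i) (hu i))
      (by rwa [mulVec_add, dotProduct_add, h, zero_add])
    have := F.sub_mem hwu (key u hu huv)
    rwa [add_vecMul, add_vecMul, Pi.add_apply, mul_add, add_sub_cancel_right] at this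
  · exact key w hw h

end Transvections

lemma IsTransvection.conj {L : Type*} [Field L] {n : ℕ} (A : (Matrix (Fin n) (Fin n) L)ˣ)
    {T : (Matrix (Fin n) (Fin n) L)ˣ} (hT : IsTransvection (T : Matrix (Fin n) (Fin n) L)) :
    IsTransvection ((A * T * A⁻¹ : (Matrix (Fin n) (Fin n) L)ˣ) : Matrix (Fin n) (Fin n) L) := by
  obtain ⟨h1, h2⟩ := hT
  refine ⟨fun h => h1 ?_, ?_⟩
  · have : A * T * A⁻¹ = 1 := Units.ext h
    simpa using congrArg Units.val (conj_eq_one_iff.mp this)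
  · have : ((A * T * A⁻¹ : (Matrix (Fin n) (Fin n) L)ˣ) : Matrix (Fin n) (Fin n) L) - 1 =
        (A : Matrix (Fin n) (Fin n) L) * (T - 1) * (A⁻¹ : (Matrix (Fin n) (Fin n) L)ˣ) := by
      rw [mul_sub, sub_mul, mul_one, Units.mul_inv, Units.val_mul, Units.val_mul]
    rw [this, rank_mul_eq_left_of_isUnit_det _ _ ((isUnit_iff_isUnit_det _).mp (Units.isUnit _)),
      rank_mul_eq_right_of_isUnit_det _ _ ((isUnit_iff_isUnit_det _).mp (Units.isUnit _)), h2]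

lemma conj_mem_closure_transvections {L : Type*} [Field L] {n : ℕ}
    {G : Subgroup (Matrix (Fin n) (Fin n) L)ˣ} {A T : (Matrix (Fin n) (Fin n) L)ˣ} (hA : A ∈ G)
    (hT : T ∈ Subgroup.closure {B | B ∈ G ∧ IsTransvection (B : Matrix (Fin n) (Fin n) L)}) :
    A * T * A⁻¹ ∈
      Subgroup.closure {B | B ∈ G ∧ IsTransvection (B : Matrix (Fin n) (Fin n) L)} := by
  induction hT using Subgroup.closure_induction with
  | mem T h =>
    exact Subgroup.subset_closure ⟨G.mul_mem (G.mul_mem hA h.1) (G.inv_mem hA), h.2.conj A⟩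
  | one => simp
  | mul S T _ _ hS hT => simpa [mul_assoc] using mul_mem hS hT
  | inv T _ hT => simpa [mul_assoc] using inv_mem hT

lemma isUnit_and_similitude_of_smul_map {K L : Type*} [Field K] [Field L] [Algebra K L] {n : ℕ}
    (hn : 2 ≤ n) {A : Matrix (Fin n) (Fin n) L} (hA : IsUnit A) {α : L} (hα : α ≠ 0)
    (hAJ : Aᵀ * stdJ n L * A = α • stdJ n L) {c : L} (hc : c ≠ 0) {B : Matrix (Fin n) (Fin n) K}
    (hB : A = c • B.map (algebraMap K L)) :
    IsUnit B ∧ ∃ β : Kˣ, Bᵀ * stdJ n K * B = (β : K) • stdJ n K := by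
  have hinj := FaithfulSMul.algebraMap_injective K L
  constructor
  · rw [isUnit_iff_isUnit_det, isUnit_iff_ne_zero] at hA ⊢
    rintro h
    apply hA
    rw [hB, det_smul, ← RingHom.mapMatrix_apply, ← RingHom.map_det, h, map_zero, mul_zero]
  · have hmap : (Bᵀ * stdJ n K * B).map (algebraMap K L) = (α / c ^ 2) • stdJ n L := by
      rw [Matrix.map_mul, Matrix.map_mul, stdJ_map, transpose_map, div_eq_inv_mul, mul_smul,
        ← hAJ, hB, transpose_smul, Matrix.smul_mul, Matrix.smul_mul, Matrix.mul_smul, smul_smul,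
        smul_smul, show (c ^ 2)⁻¹ * c * c = 1 by field_simp, one_smul]
    set β : K := (Bᵀ * stdJ n K * B) ⟨0, by omega⟩ ⟨n / 2, by omega⟩ with hβ
    have hβα : algebraMap K L β = α / c ^ 2 := by
      have := congrFun (congrFun hmap ⟨0, by omega⟩) ⟨n / 2, by omega⟩
      rwa [map_apply, Matrix.smul_apply, stdJ_zero_half hn, smul_eq_mul, mul_one] at this
    have hβ0 : β ≠ 0 := fun h => div_ne_zero hα (pow_ne_zero 2 hc) (by rw [← hβα, h, map_zero])
    refine ⟨Units.mk0 β hβ0, map_injective hinj ?_⟩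
    dsimp only
    rw [hmap, ← hβα, ← stdJ_map (algebraMap K L)]
    ext i j
    simp

/-- If `K` is a finite field of characteristic ≠ 2, and the subgroup of
`G ⊆ GSp_n(K̄)` generated by the transvections in `G` equals `Sp_n(K)`, then every
element of `G` is a scalar multiple of a matrix in `GSp_n(K)`. -/
theorem subgroup_in_GSpK_times_scalars
    {K : Type*} [Field K] [Fintype K] (hchar : ringChar K ≠ 2)
    {n : ℕ} (hn2 : 2 ≤ n) (hneven : Even n)
    (G : Subgroup (Matrix (Fin n) (Fin n) (AlgebraicClosure K))ˣ)
    (hGSp : ∀ A ∈ G, ∃ α : (AlgebraicClosure K)ˣ,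
      (A : Matrix (Fin n) (Fin n) (AlgebraicClosure K))ᵀ * stdJ n (AlgebraicClosure K)
        * (A : Matrix (Fin n) (Fin n) (AlgebraicClosure K))
        = (α : AlgebraicClosure K) • stdJ n (AlgebraicClosure K))
    (hgen : (Subgroup.closure {A | A ∈ G ∧
        IsTransvection (A : Matrix (Fin n) (Fin n) (AlgebraicClosure K))} :
        Set (Matrix (Fin n) (Fin n) (AlgebraicClosure K))ˣ) = SpOver K n) :
    ∀ A ∈ G, ∃ (lam : (AlgebraicClosure K)ˣ) (B : Matrix (Fin n) (Fin n) K),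
      (IsUnit B ∧ ∃ β : Kˣ, Bᵀ * stdJ n K * B = (β : K) • stdJ n K) ∧
      (A : Matrix (Fin n) (Fin n) (AlgebraicClosure K))
        = (lam : AlgebraicClosure K) • B.map (algebraMap K (AlgebraicClosure K)) := by
  intro A hA
  have h2 : (2 : AlgebraicClosure K) ≠ 0 := by
    have := Ring.two_ne_zero hchar
    rw [← map_ofNat (algebraMap K (AlgebraicClosure K)) 2]
    exact (map_ne_zero _).mpr this
  set F : Subfield (AlgebraicClosure K) := (algebraMap K (AlgebraicClosure K)).fieldRange
  set J := stdJ n (AlgebraicClosure K)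
  have hJF : ∀ i j, J i j ∈ F := stdJ_mem_subfield F
  have hJt : Jᵀ = -J := stdJ_transpose hn2
  have hself : ∀ v : Fin n → AlgebraicClosure K, (∀ i, v i ∈ F) → ∀ a b,
      (A.val *ᵥ v) a * (v ᵥ* J ᵥ* A⁻¹.val) b ∈ F := by
    intro v hv a b
    have hv0 := dotProduct_mulVec_self_of_transpose_eq_neg h2 hJt v
    have hT : symplecticTransvection J v hv0 ∈ SpOver K n := by
      refine ⟨fun i j => ?_, symplecticTransvection_preserves hJt hv0⟩
      change (1 + vecMulVec v (v ᵥ* J)) i j ∈ F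
      rw [Matrix.add_apply, vecMulVec_apply]
      refine F.add_mem ?_ (F.mul_mem (hv i)
        (show ∑ k, v k * J k j ∈ F from F.sum_mem fun k _ => F.mul_mem (hv k) (hJF k j)))
      rw [one_apply]
      split_ifs
      exacts [F.one_mem, F.zero_mem]
    rw [← hgen] at hT
    have hconj := conj_mem_closure_transvections hA hT
    rw [← SetLike.mem_coe, hgen] at hconj
    have hab : (A.val * (1 + vecMulVec v (v ᵥ* J)) * A⁻¹.val) a b ∈ F := hconj.1 a b
    rw [mul_add, add_mul, mul_one, Units.mul_inv, mul_vecMulVec, vecMulVec_mul,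
      Matrix.add_apply, vecMulVec_apply] at hab
    have h1 : (1 : Matrix (Fin n) (Fin n) (AlgebraicClosure K)) a b ∈ F := by
      rw [one_apply]
      split_ifs
      exacts [F.one_mem, F.zero_mem]
    simpa using F.sub_mem hab h1
  have hsingle : ∀ i k : Fin n, (Pi.single i 1 : Fin n → AlgebraicClosure K) k ∈ F := by
    intro i k
    rw [Pi.single_apply]
    split_ifs
    exacts [F.one_mem, F.zero_mem]
  have hC : J * A⁻¹.val ≠ 0 := by
    rw [Ne, Units.mul_left_eq_zero]
    intro h
    obtain ⟨k, hk⟩ := exists_stdJ_ne_zero (R := AlgebraicClosure K) hneven ⟨0, by omega⟩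
    exact hk (congrFun (congrFun h _) k)
  obtain ⟨c, hc⟩ := exists_smul_of_mul_mem (F := F) (A := A.val) hC (fun i j a b => by
      obtain ⟨k, hk⟩ := exists_stdJ_ne_zero (R := AlgebraicClosure K) hneven i
      have := conj_vecMulVec_mem (Units.inv_mul A) hJF hself (hsingle k) (hsingle i) (hsingle j)
        (by simpa using hk) a b
      rw [mulVec_single_one, vecMul_vecMul, single_one_vecMul] at this
      exact this)
  choose B hB using hc
  have hAB : (A : Matrix (Fin n) (Fin n) (AlgebraicClosure K)) =
      (c : AlgebraicClosure K) • (of B).map (algebraMap K (AlgebraicClosure K)) := by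
    ext i j
    simp [hB]
  obtain ⟨α, hα⟩ := hGSp A hA
  exact ⟨c, of B, isUnit_and_similitude_of_smul_map hn2 A.isUnit α.ne_zero hα c.ne_zero hAB, hAB⟩
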